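/- arXiv:2306.08499 — 3 statements merged into one kernel-verified Lean document; each statement's English description precedes it below -/
import Mathlib

section
/- Let p be a real number with 0 < p ≤ 2, and let a > 0 and b ≥ 0 be real numbers. Then (1/p) b^p ≤ (1/2) a^{p−2} b^2 + (1/p − 1/2) a^p, with equality when b = a. -/
theorem stmt_2 (p a b : ℝ) (hp : 0 < p) (hp2 : p ≤ 2) (ha : 0 < a) (hb : 0 ≤ b) :
    (1 / p) * b ^ p ≤ (1 / 2) * a ^ (p - 2) * b ^ 2 + (1 / p - 1 / 2) * a ^ p
    ∧ (1 / p) * a ^ p = (1 / 2) * a ^ (p - 2) * a ^ 2 + (1 / p - 1 / 2) * a ^ p := by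
  constructor
  · have h := Real.geom_mean_le_arith_mean2_weighted (w₁ := p / 2) (w₂ := 1 - p / 2)
      (p₁ := a ^ (p - 2) * b ^ 2) (p₂ := a ^ p) (by linarith) (by linarith)
      (by positivity) (by positivity) (by ring)
    have e1 : (b ^ 2) ^ (p / 2) = b ^ p := by
      rw [← Real.rpow_natCast b 2, ← Real.rpow_mul hb]
      congr 1
      push_cast
      ring
    have e2 : (a ^ (p - 2) * b ^ 2) ^ (p / 2) * (a ^ p) ^ (1 - p / 2) = b ^ p := by
      rw [Real.mul_rpow (by positivity) (by positivity), e1, ← Real.rpow_mul ha.le,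
        ← Real.rpow_mul ha.le, mul_right_comm, ← Real.rpow_add ha]
      have : (p - 2) * (p / 2) + p * (1 - p / 2) = 0 := by ring
      rw [this, Real.rpow_zero, one_mul]
    rw [e2] at h
    have h2 := mul_le_mul_of_nonneg_left h (by positivity : 0 ≤ 1 / p)
    refine h2.trans (le_of_eq ?_)
    field_simp
  · have e : a ^ (p - 2) * a ^ 2 = a ^ p := by
      rw [← Real.rpow_natCast a 2, ← Real.rpow_add ha]
      congr 1
      push_cast
      ring
    rw [mul_assoc, e]
    ring
end

section
/- Let p ∈ (0, 2] and let z̄ ∈ ℝ^n with z̄_j ≠ 0 for all j. Define Φ(z) = (1/p) ∑_{j=1}^n |z_j|^p and Φ^{z̄}(z) = (1/2) ∑_{j=1}^n |z̄_j|^{p−2} z_j^2 + (1/p − 1/2) ∑_{j=1}^n |z̄_j|^p. Then Φ^{z̄}(z̄) = Φ(z̄), and Φ^{z̄}(z) ≥ Φ(z) for every z ∈ ℝ^n; that is, Φ^{z̄} is a quadratic majorant of Φ that is tangent at z̄. -/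
theorem aux_majorant (p a z : ℝ) (hp : 0 < p) (hp2 : p ≤ 2) (ha : 0 < a) :
    |z| ^ p ≤ p / 2 * (a ^ (p - 2) * z ^ 2) + (1 - p / 2) * a ^ p := by
  have h := Real.geom_mean_le_arith_mean2_weighted (w₁ := p / 2) (w₂ := 1 - p / 2)
    (p₁ := a ^ (p - 2) * z ^ 2) (p₂ := a ^ p) (by linarith) (by linarith)
    (by positivity) (by positivity) (by ring)
  have e : (a ^ (p - 2) * z ^ 2) ^ (p / 2) * (a ^ p) ^ (1 - p / 2) = |z| ^ p := by
    have hz : (z ^ 2) ^ (p / 2) = |z| ^ p := by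
      rw [← sq_abs, ← Real.rpow_natCast, ← Real.rpow_mul (abs_nonneg z)]
      congr 1
      push_cast
      ring
    rw [Real.mul_rpow (by positivity) (by positivity), hz, ← Real.rpow_mul ha.le,
      ← Real.rpow_mul ha.le, mul_right_comm, ← Real.rpow_add ha]
    have : (p - 2) * (p / 2) + p * (1 - p / 2) = 0 := by ring
    rw [this, Real.rpow_zero, one_mul]
  rwa [e] at h

theorem stmt_3 (n : ℕ) (p : ℝ) (hp : 0 < p) (hp2 : p ≤ 2)
    (zb : Fin n → ℝ) (hzb : ∀ j, zb j ≠ 0) :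
    ((1 / 2) * ∑ j, |zb j| ^ (p - 2) * (zb j) ^ 2
        + (1 / p - 1 / 2) * ∑ j, |zb j| ^ p)
      = (1 / p) * ∑ j, |zb j| ^ p
    ∧ ∀ z : Fin n → ℝ,
        (1 / p) * ∑ j, |z j| ^ p
          ≤ (1 / 2) * ∑ j, |zb j| ^ (p - 2) * (z j) ^ 2
            + (1 / p - 1 / 2) * ∑ j, |zb j| ^ p := by
  constructor
  · have : ∀ j, |zb j| ^ (p - 2) * (zb j) ^ 2 = |zb j| ^ p := by
      intro j
      have hj := abs_pos.mpr (hzb j)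
      rw [← sq_abs (zb j), ← Real.rpow_natCast, ← Real.rpow_add hj]
      congr 1
      push_cast
      ring
    simp only [this]
    ring
  · intro z
    rw [Finset.mul_sum, Finset.mul_sum, Finset.mul_sum, ← Finset.sum_add_distrib]
    refine Finset.sum_le_sum fun j _ => ?_
    have h := aux_majorant p |zb j| (z j) hp hp2 (abs_pos.mpr (hzb j))
    have h2 := mul_le_mul_of_nonneg_left h (one_div_pos.mpr hp).le
    refine h2.trans (le_of_eq ?_)
    field_simp
end

section
/- Let z̄ ∈ ℝ^n and let g_1, …, g_s be a family of groups with ‖z̄_{g_i}‖_2 > 0 for every i. Define the diagonal weight matrix W(z̄) by W(z̄)_{j,j} = (∑_{i ∈ G_j} 1/‖z̄_{g_i}‖_2)^{1/2}. Then for every z ∈ ℝ^n, ‖z‖_{2,1} ≤ (1/2)‖W(z̄) z‖_2^2 + (1/2)‖z̄‖_{2,1}, with equality when z = z̄; that is, z ↦ (1/2)‖W(z̄) z‖_2^2 + (1/2)‖z̄‖_{2,1} is a quadratic majorant of the ℓ_{2,1} norm that is tangent at z̄. -/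
open Finset Matrix

theorem stmt_5 (n s : ℕ) (zb : Fin n → ℝ) (g : Fin s → Finset (Fin n))
    (hpos : ∀ i, 0 < Real.sqrt (∑ j ∈ g i, (zb j) ^ 2))
    (W : Matrix (Fin n) (Fin n) ℝ)
    (hW : W = Matrix.diagonal (fun j =>
      Real.sqrt (∑ i ∈ Finset.univ.filter (fun i => j ∈ g i),
        1 / Real.sqrt (∑ k ∈ g i, (zb k) ^ 2)))) :
    (∀ z : Fin n → ℝ,
      ∑ i, Real.sqrt (∑ j ∈ g i, (z j) ^ 2)
        ≤ (1 / 2) * ∑ j, (W.mulVec z j) ^ 2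
          + (1 / 2) * ∑ i, Real.sqrt (∑ j ∈ g i, (zb j) ^ 2))
    ∧ (∑ i, Real.sqrt (∑ j ∈ g i, (zb j) ^ 2)
        = (1 / 2) * ∑ j, (W.mulVec zb j) ^ 2
          + (1 / 2) * ∑ i, Real.sqrt (∑ j ∈ g i, (zb j) ^ 2)) := by
  have key : ∀ z : Fin n → ℝ, ∑ j, (W.mulVec z j) ^ 2
      = ∑ i, (∑ j ∈ g i, (z j) ^ 2) / Real.sqrt (∑ k ∈ g i, (zb k) ^ 2) := by
    intro z
    have h1 : ∀ j, (W.mulVec z j) ^ 2 = ∑ i, if j ∈ g i then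
        (z j) ^ 2 / Real.sqrt (∑ k ∈ g i, (zb k) ^ 2) else 0 := by
      intro j
      rw [hW, Matrix.mulVec_diagonal, mul_pow, Real.sq_sqrt
        (Finset.sum_nonneg fun i _ => (one_div_pos.mpr (hpos i)).le),
        Finset.sum_mul, Finset.sum_filter]
      refine Finset.sum_congr rfl fun i _ => ?_
      split_ifs
      · ring
      · rfl
    rw [Finset.sum_congr rfl fun j _ => h1 j, Finset.sum_comm]
    refine Finset.sum_congr rfl fun i _ => ?_
    rw [Finset.sum_div, ← Finset.sum_filter]
    simp
  constructor
  · intro z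
    rw [key z, Finset.mul_sum, Finset.mul_sum, ← Finset.sum_add_distrib]
    refine Finset.sum_le_sum fun i _ => ?_
    have hb := hpos i
    have ha := Real.sq_sqrt (Finset.sum_nonneg fun j (_ : j ∈ g i) => sq_nonneg (z j))
    generalize Real.sqrt (∑ j ∈ g i, (z j) ^ 2) = a at *
    generalize Real.sqrt (∑ j ∈ g i, (zb j) ^ 2) = b at *
    rw [← ha]
    have h : 1 / 2 * (a ^ 2 / b) + 1 / 2 * b - a = (a - b) ^ 2 / (2 * b) := by
      field_simp
      ring
    have h2 : 0 ≤ (a - b) ^ 2 / (2 * b) := by positivity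
    linarith
  · have h : ∑ j, (W.mulVec zb j) ^ 2 = ∑ i, Real.sqrt (∑ j ∈ g i, (zb j) ^ 2) := by
      rw [key zb]
      exact Finset.sum_congr rfl fun i _ => Real.div_sqrt
    rw [h]
    ring
end
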